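/- (Basis of the right orthogonal complement of e_γ.) With e_α, e_γ, e_β the exceptional characters associated to (p−1)/2ⁿ, p/2ⁿ and (p+1)/2ⁿ respectively, the vectors e_α and τ(e_β) are linearly independent in ℝ³ and their real linear span equals {v ∈ ℝ³ : χ(e_γ, v) = 0}; consequently every w ∈ ℝ³ with χ(e_γ, w) = 0 can be written uniquely as w = n₂·e_α − n₁·τ(e_β) with n₁, n₂ ∈ ℝ. -/

import Mathlib

/-- The Euler pairing (Hirzebruch–Riemann–Roch on P²) on `K(P²)⊗ℝ ≅ ℝ³`,
identifying `v = (ch₀ v, ch₁ v, ch₂ v)`. -/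
noncomputable def chi (v w : ℝ × ℝ × ℝ) : ℝ :=
  v.2.2 * w.1 + w.2.2 * v.1 - v.2.1 * w.2.1 + (3 / 2) * (w.2.1 * v.1 - w.1 * v.2.1) + v.1 * w.1

/-- The Serre twist `τ(v)`, the Chern character of `V ⊗ O(−3)`. -/
noncomputable def tau (v : ℝ × ℝ × ℝ) : ℝ × ℝ × ℝ :=
  (v.1, v.2.1 - 3 * v.1, v.2.2 - 3 * v.2.1 + (9 / 2) * v.1)

/-- `vtil m p` is the exceptional character `ṽ(p / 2^m) ∈ ℝ³`, defined recursively: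
`ṽ(n) = (1, n, n²/2)` for integers `n`; for odd `p` and `m > 0`,
if `p ≡ 3 (mod 4)` then `ṽ(p/2^m) = 3·ch₀(ṽ((p+1)/2^m))·ṽ((p−1)/2^m) − ṽ((p−3)/2^m)`,
and if `p ≡ 1 (mod 4)` then `ṽ(p/2^m) = 3·ch₀(ṽ((p−1)/2^m))·ṽ((p+1)/2^m) − ṽ((p+3)/2^m)`.
For even `p` we reduce the fraction, so `vtil` is well defined on dyadic rationals
(each dyadic rational `q` is represented as `p / 2^m`). -/
noncomputable def vtil : ℕ → ℤ → ℝ × ℝ × ℝ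
  | 0, p => (1, (p : ℝ), (p : ℝ) ^ 2 / 2)
  | m + 1, p =>
    if p % 2 = 0 then vtil m (p / 2)
    else if p % 4 = 3 then
      (3 * (vtil m ((p + 1) / 2)).1) • vtil m ((p - 1) / 2) - vtil m ((p - 3) / 2)
    else
      (3 * (vtil m ((p - 1) / 2)).1) • vtil m ((p + 1) / 2) - vtil m ((p + 3) / 2)

theorem chi_add_left (x y w : ℝ × ℝ × ℝ) : chi (x + y) w = chi x w + chi y w := by
  simp only [chi, Prod.fst_add, Prod.snd_add]; ring

theorem chi_add_right (w x y : ℝ × ℝ × ℝ) : chi w (x + y) = chi w x + chi w y := by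
  simp only [chi, Prod.fst_add, Prod.snd_add]; ring

theorem chi_sub_left (x y w : ℝ × ℝ × ℝ) : chi (x - y) w = chi x w - chi y w := by
  simp only [chi, Prod.fst_sub, Prod.snd_sub]; ring

theorem chi_sub_right (w x y : ℝ × ℝ × ℝ) : chi w (x - y) = chi w x - chi w y := by
  simp only [chi, Prod.fst_sub, Prod.snd_sub]; ring

theorem chi_smul_left (c : ℝ) (x w : ℝ × ℝ × ℝ) : chi (c • x) w = c * chi x w := by
  simp only [chi, Prod.smul_fst, Prod.smul_snd, smul_eq_mul]; ring

theorem chi_smul_right (c : ℝ) (w x : ℝ × ℝ × ℝ) : chi w (c • x) = c * chi w x := by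
  simp only [chi, Prod.smul_fst, Prod.smul_snd, smul_eq_mul]; ring

/-- Numerical Serre duality. -/
theorem chi_tau (x y : ℝ × ℝ × ℝ) : chi x (tau y) = chi y x := by
  simp only [chi, tau]; ring

theorem eq_zero_of_forall_chi_eq_zero {u : ℝ × ℝ × ℝ} (h : ∀ x, chi x u = 0) : u = 0 := by
  obtain ⟨r, c, d⟩ := u
  have h₁ := h (0, 0, 1)
  have h₂ := h (0, 1, 0)
  have h₃ := h (1, 0, 0)
  simp only [chi] at h₁ h₂ h₃
  have hr : r = 0 := by linarith
  have hc : c = 0 := by linarith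
  have hd : d = 0 := by linarith
  simp [hr, hc, hd]

/-- The numerical relations satisfied by the characters of an exceptional triple in a
dyadic helix. -/
structure IsExceptionalTriple (a g b : ℝ × ℝ × ℝ) : Prop where
  aa : chi a a = 1
  gg : chi g g = 1
  bb : chi b b = 1
  ga : chi g a = 0
  bg : chi b g = 0
  ba : chi b a = 0
  ag : chi a g = 3 * b.1
  gb : chi g b = 3 * a.1
  ab : chi a b = 9 * a.1 * b.1 - 3 * g.1

namespace IsExceptionalTriple

variable {a g b : ℝ × ℝ × ℝ}

theorem rightMutation (h : IsExceptionalTriple a g b) :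
    IsExceptionalTriple g ((3 * b.1) • g - a) b := by
  obtain ⟨aa, gg, bb, ga, bg, ba, ag, gb, ab⟩ := h
  constructor <;>
    simp only [chi_sub_left, chi_sub_right, chi_smul_left, chi_smul_right, aa, gg, bb, ga, bg, ba,
      ag, gb, ab, Prod.fst_sub, Prod.smul_fst, smul_eq_mul] <;> ring

theorem leftMutation (h : IsExceptionalTriple a g b) :
    IsExceptionalTriple a ((3 * a.1) • g - b) g := by
  obtain ⟨aa, gg, bb, ga, bg, ba, ag, gb, ab⟩ := h
  constructor <;>
    simp only [chi_sub_left, chi_sub_right, chi_smul_left, chi_smul_right, aa, gg, bb, ga, bg, ba,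
      ag, gb, ab, Prod.fst_sub, Prod.smul_fst, smul_eq_mul] <;> ring

theorem linearIndependent (h : IsExceptionalTriple a g b) :
    LinearIndependent ℝ ![a, g, b] := by
  rw [Fintype.linearIndependent_iff]
  intro c hc
  simp only [Fin.sum_univ_three, Matrix.cons_val] at hc
  have key : ∀ x, c 0 * chi x a + c 1 * chi x g + c 2 * chi x b = 0 := fun x => by
    rw [← chi_smul_right, ← chi_smul_right, ← chi_smul_right, ← chi_add_right, ← chi_add_right, hc]
    simp [chi]
  have hb := key b
  have hg := key g
  have ha := key a
  simp only [h.ba, h.bg, h.bb, mul_zero, zero_add, mul_one] at hb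
  simp only [hb, h.ga, h.gg, mul_zero, zero_add, mul_one, zero_mul, add_zero] at hg
  simp only [hb, hg, h.aa, mul_one, zero_mul, add_zero] at ha
  intro i
  fin_cases i <;> assumption

theorem eq_zero_of_chi_eq_zero (h : IsExceptionalTriple a g b) {u : ℝ × ℝ × ℝ}
    (ha : chi a u = 0) (hg : chi g u = 0) (hb : chi b u = 0) : u = 0 := by
  refine eq_zero_of_forall_chi_eq_zero fun x => ?_
  have hx : x ∈ Submodule.span ℝ (Set.range ![a, g, b]) := by
    rw [h.linearIndependent.span_eq_top_of_card_eq_finrank (by simp)]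
    trivial
  obtain ⟨c, rfl⟩ := (Submodule.mem_span_range_iff_exists_fun ℝ).1 hx
  simp [Fin.sum_univ_three, chi_add_left, chi_smul_left, ha, hg, hb]

theorem eq_of_chi_eq_zero (h : IsExceptionalTriple a g b) {w : ℝ × ℝ × ℝ} (hw : chi g w = 0) :
    chi a w • a + chi b w • tau b = w := by
  refine sub_eq_zero.1 (h.eq_zero_of_chi_eq_zero ?_ ?_ ?_) <;>
    simp [chi_sub_right, chi_add_right, chi_smul_right, chi_tau, h.aa, h.bb, h.ga, h.bg, h.ba, hw]

theorem chi_left (h : IsExceptionalTriple a g b) (s t : ℝ) :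
    chi a (s • a + t • tau b) = s := by
  simp [chi_add_right, chi_smul_right, chi_tau, h.aa, h.ba]

theorem chi_middle (h : IsExceptionalTriple a g b) (s t : ℝ) :
    chi g (s • a + t • tau b) = 0 := by
  simp [chi_add_right, chi_smul_right, chi_tau, h.ga, h.bg]

theorem chi_right (h : IsExceptionalTriple a g b) (s t : ℝ) :
    chi b (s • a + t • tau b) = t := by
  simp [chi_add_right, chi_smul_right, chi_tau, h.bb, h.ba]

end IsExceptionalTriple

theorem vtil_two_mul (m : ℕ) (k : ℤ) : vtil (m + 1) (2 * k) = vtil m k := by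
  simp [vtil]

theorem isExceptionalTriple_vtil (n : ℕ) (p : ℤ) (hp : 0 < n → Odd p) :
    IsExceptionalTriple (vtil n (p - 1)) (vtil n p) (vtil n (p + 1)) := by
  induction n generalizing p with
  | zero => constructor <;> simp only [vtil, chi] <;> push_cast <;> ring
  | succ m ih =>
    have hodd := Int.odd_iff.1 (hp m.succ_pos)
    obtain h4 | h4 : p % 4 = 3 ∨ p % 4 = 1 := by omega
    · obtain ⟨k, rfl, hk⟩ : ∃ k, p = 2 * k + 1 ∧ Odd k :=
        ⟨(p - 1) / 2, by omega, Int.odd_iff.2 (by omega)⟩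
      have hg : vtil (m + 1) (2 * k + 1) =
          (3 * (vtil m (k + 1)).1) • vtil m k - vtil m (k - 1) := by
        rw [vtil, if_neg (by omega), if_pos h4, show (2 * k + 1 + 1) / 2 = k + 1 by omega,
          show (2 * k + 1 - 1) / 2 = k by omega, show (2 * k + 1 - 3) / 2 = k - 1 by omega]
      rw [hg, show 2 * k + 1 - 1 = 2 * k by ring, show 2 * k + 1 + 1 = 2 * (k + 1) by ring,
        vtil_two_mul, vtil_two_mul]
      exact (ih k fun _ => hk).rightMutation
    · obtain ⟨k, rfl, hk⟩ : ∃ k, p = 2 * k - 1 ∧ Odd k :=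
        ⟨(p + 1) / 2, by omega, Int.odd_iff.2 (by omega)⟩
      have hg : vtil (m + 1) (2 * k - 1) =
          (3 * (vtil m (k - 1)).1) • vtil m k - vtil m (k + 1) := by
        rw [vtil, if_neg (by omega), if_neg (by omega), show (2 * k - 1 + 1) / 2 = k by omega,
          show (2 * k - 1 - 1) / 2 = k - 1 by omega, show (2 * k - 1 + 3) / 2 = k + 1 by omega]
      rw [hg, show 2 * k - 1 - 1 = 2 * (k - 1) by ring, show 2 * k - 1 + 1 = 2 * k by ring,
        vtil_two_mul, vtil_two_mul]
      exact (ih k fun _ => hk).leftMutation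

/-- Basis of the right orthogonal complement of `e_γ`: with `e_α = ṽ((p−1)/2ⁿ)`,
`e_γ = ṽ(p/2ⁿ)`, `e_β = ṽ((p+1)/2ⁿ)` (`p` odd when `n > 0`), the vectors `e_α` and
`τ(e_β)` are linearly independent, their span equals `{v | χ(e_γ, v) = 0}`, and every
`w` with `χ(e_γ, w) = 0` is uniquely `w = n₂·e_α − n₁·τ(e_β)`. -/
theorem basis_of_right_orthogonal (n : ℕ) (p : ℤ) (hp : 0 < n → Odd p) :
    LinearIndependent ℝ ![vtil n (p - 1), tau (vtil n (p + 1))] ∧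
    (Submodule.span ℝ ({vtil n (p - 1), tau (vtil n (p + 1))} : Set (ℝ × ℝ × ℝ)) :
        Set (ℝ × ℝ × ℝ)) = {v : ℝ × ℝ × ℝ | chi (vtil n p) v = 0} ∧
    ∀ w : ℝ × ℝ × ℝ, chi (vtil n p) w = 0 →
      ∃! c : ℝ × ℝ, w = c.2 • vtil n (p - 1) - c.1 • tau (vtil n (p + 1)) := by
  have h := isExceptionalTriple_vtil n p hp
  refine ⟨LinearIndependent.pair_iff.2 fun s t hst => ?_, ?_, fun w hw => ?_⟩
  · have ha := h.chi_left s t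
    have hb := h.chi_right s t
    rw [hst] at ha hb
    exact ⟨by simpa [chi] using ha.symm, by simpa [chi] using hb.symm⟩
  · ext w
    rw [SetLike.mem_coe, Submodule.mem_span_pair, Set.mem_ofPred_eq]
    refine ⟨?_, fun hw => ⟨_, _, h.eq_of_chi_eq_zero hw⟩⟩
    rintro ⟨s, t, rfl⟩
    exact h.chi_middle s t
  · refine ⟨(-chi (vtil n (p + 1)) w, chi (vtil n (p - 1)) w), ?_, ?_⟩
    · simpa only [neg_smul, sub_neg_eq_add] using (h.eq_of_chi_eq_zero hw).symm
    · rintro ⟨s, t⟩ rfl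
      rw [sub_eq_add_neg, ← neg_smul, h.chi_left, h.chi_right, neg_neg]
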